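/- Let K = ∏_{i=1}^n [x_i⁰ − h_i, x_i⁰ + h_i] ⊂ ℝⁿ be an axis-parallel box with center x⁰ and half side-lengths h_i > 0, and set ξ_i(x) = (x_i − x_i⁰)/h_i. Let u be a real polynomial in n variables of total degree at most 3, and let q be a Wilson interpolant of u on K. Then for every x ∈ ℝⁿ, u(x) − q(x) = Σ_{i=1}^n (h_i³/6)·(∂³u/∂x_i³)·(ξ_i(x)³ − ξ_i(x)) + Σ_{i=1}^n Σ_{j≠i} (h_i²·h_j/2)·(∂³u/∂x_i²∂x_j)·(ξ_i(x)²·ξ_j(x) − ξ_j(x)), where each third-order partial derivative of u is a constant. -/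

import Mathlib

open MvPolynomial MeasureTheory

/-- A real polynomial whose partial derivatives all vanish is constant. -/
lemma wil_const {n : ℕ} (P : MvPolynomial (Fin n) ℝ) (h : ∀ j, pderiv j P = 0)
    (x0 : Fin n → ℝ) : P = C (eval x0 P) := by
  have h1 : P = C (coeff 0 P) := by
    ext m
    rw [coeff_C]
    split_ifs with hm
    · rw [hm]
    · obtain ⟨j, hj⟩ := Finsupp.ne_iff.mp (Ne.symm hm)
      have h2 := congrArg (coeff (m - Finsupp.single j 1)) (h j)
      rw [coeff_pderiv, coeff_zero] at h2
      have h3 : m - Finsupp.single j 1 + Finsupp.single j 1 = m := by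
        apply tsub_add_cancel_of_le
        rw [Finsupp.single_le_iff]
        exact Nat.one_le_iff_ne_zero.mpr hj
      rw [h3] at h2
      rcases mul_eq_zero.mp h2 with h4 | h4
      · exact h4
      · exfalso
        have : (0 : ℝ) ≤ ((m - Finsupp.single j 1 : Fin n →₀ ℕ) j : ℝ) := Nat.cast_nonneg _
        linarith
  rw [h1]
  simp

lemma wil_third {n : ℕ} (u : MvPolynomial (Fin n) ℝ) (hu : u.totalDegree ≤ 3)
    (x0 : Fin n → ℝ) (i j k : Fin n) :
    pderiv i (pderiv j (pderiv k u)) = C (eval x0 (pderiv i (pderiv j (pderiv k u)))) := by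
  apply wil_const
  intro l
  ext m
  simp only [coeff_pderiv, coeff_zero]
  rw [coeff_eq_zero_of_totalDegree_lt]
  · simp
  · refine lt_of_le_of_lt hu ?_
    change 3 < Finsupp.degree _
    simp only [map_add, Finsupp.degree_single]
    omega

lemma wil_affine {n : ℕ} (P : MvPolynomial (Fin n) ℝ) (x0 b : Fin n → ℝ)
    (h : ∀ j, pderiv j P = C (b j)) :
    P = C (eval x0 P) + ∑ j, C (b j) * (X j - C (x0 j)) := by
  have := wil_const (P - ∑ j, C (b j) * (X j - C (x0 j))) (by
    intro j
    simp only [map_sub, map_sum, pderiv_C_mul, pderiv_C, h, pderiv_X, sub_zero, Pi.single_apply]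
    simp) x0
  rw [sub_eq_iff_eq_add] at this
  simpa using this

lemma wil_deg_to {n : ℕ} (P : MvPolynomial (Fin n) ℝ) (i : Fin n) (h : P.degreeOf i ≤ 1) :
    pderiv i (pderiv i P) = 0 := by
  ext m
  simp only [coeff_pderiv, coeff_zero]
  have : coeff (m + Finsupp.single i 1 + Finsupp.single i 1) P = 0 := by
    by_contra hc
    have h2 := (degreeOf_lt_iff (n := i) (f := P) (d := 2) (by norm_num)).mp (by omega) _
      (mem_support_iff.mpr hc)
    simp at h2
  rw [this]
  simp

lemma wil_deg_of {n : ℕ} (P : MvPolynomial (Fin n) ℝ) (i : Fin n)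
    (h : pderiv i (pderiv i P) = 0) : P.degreeOf i < 2 := by
  rw [degreeOf_lt_iff (by norm_num)]
  intro m hm
  by_contra hc
  apply mem_support_iff.mp hm
  have h3 : m - Finsupp.single i 2 + Finsupp.single i 1 + Finsupp.single i 1 = m := by
    rw [add_assoc, ← Finsupp.single_add]
    apply tsub_add_cancel_of_le
    rw [Finsupp.single_le_iff]
    omega
  have h2 := congrArg (coeff (m - Finsupp.single i 2)) h
  simp only [coeff_pderiv, coeff_zero] at h2
  rw [h3] at h2
  rcases mul_eq_zero.mp h2 with h4 | h4
  · rcases mul_eq_zero.mp h4 with h5 | h5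
    · exact h5
    · exfalso
      have : (0 : ℝ) ≤ ((m - Finsupp.single i 2 + Finsupp.single i 1 : Fin n →₀ ℕ) i : ℝ) :=
        Nat.cast_nonneg _
      linarith
  · exfalso
    have : (0 : ℝ) ≤ ((m - Finsupp.single i 2 : Fin n →₀ ℕ) i : ℝ) := Nat.cast_nonneg _
    linarith

/-- Mean value over the box of an affine function. -/
lemma wil_int {n : ℕ} (x0 hh : Fin n → ℝ) (d : ℝ) (b : Fin n → ℝ) :
    (∫ x in Set.univ.pi fun j => Set.Icc (x0 j - hh j) (x0 j + hh j),
      eval x (C d + ∑ j, C (b j) * (X j - C (x0 j)) : MvPolynomial (Fin n) ℝ))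
    = (volume (Set.univ.pi fun j => Set.Icc (x0 j - hh j) (x0 j + hh j))).toReal * d := by
  set S := Set.univ.pi fun j => Set.Icc (x0 j - hh j) (x0 j + hh j) with hS
  set P : MvPolynomial (Fin n) ℝ := C d + ∑ j, C (b j) * (X j - C (x0 j)) with hP
  have hK : IsCompact S := isCompact_univ_pi fun j => isCompact_Icc
  have hmp : MeasurePreserving (fun x : Fin n → ℝ => (x0 + x0) - x) volume volume :=
    Measure.measurePreserving_sub_left volume (x0 + x0)
  have hint : ∀ f : (Fin n → ℝ) → ℝ, Continuous f → IntegrableOn f S := fun f hf =>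
    hf.continuousOn.integrableOn_compact hK
  have hpre : (fun x : Fin n → ℝ => (x0 + x0) - x) ⁻¹' S = S := by
    ext x
    simp only [hS, Set.mem_preimage, Set.mem_univ_pi, Set.mem_Icc, Pi.sub_apply, Pi.add_apply]
    constructor <;> intro h j <;> constructor <;> linarith [(h j).1, (h j).2]
  have hrefl : ∫ x in S, eval ((x0 + x0) - x) P = ∫ x in S, eval x P := by
    have := hmp.setIntegral_preimage_emb
      (MeasurableEquiv.subLeft (x0 + x0)).measurableEmbedding (fun x => eval x P) S
    rwa [hpre] at this
  have hc : Continuous fun x => eval x P := MvPolynomial.continuous_eval P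
  have hsum : (∫ x in S, eval x P) + ∫ x in S, eval ((x0 + x0) - x) P = ∫ x in S, 2 * d := by
    rw [← integral_add (hint _ hc) (hint (fun x => eval ((x0 + x0) - x) P)
      (hc.comp (continuous_const.sub continuous_id)))]
    congr 1
    ext x
    simp only [hP, map_add, map_sum, map_mul, map_sub, eval_C, eval_X, Pi.sub_apply, Pi.add_apply]
    have : (∑ j, b j * (x j - x0 j)) + ∑ j, b j * (x0 j + x0 j - x j - x0 j) = 0 := by
      rw [← Finset.sum_add_distrib]
      exact Finset.sum_eq_zero fun j _ => by ring
    linarith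
  rw [hrefl, setIntegral_const, smul_eq_mul] at hsum
  have : volume.real S = (volume S).toReal := rfl
  rw [this] at hsum
  linarith

lemma wil_vol {n : ℕ} (x0 hh : Fin n → ℝ) (hp : ∀ i, 0 < hh i) :
    (volume (Set.univ.pi fun j => Set.Icc (x0 j - hh j) (x0 j + hh j))).toReal ≠ 0 := by
  rw [volume_pi_pi, ENNReal.toReal_prod]
  apply Finset.prod_ne_zero_iff.mpr
  intro i _
  rw [Real.volume_Icc, ENNReal.toReal_ofReal] <;> linarith [hp i]

/-- Scaled coordinate as a polynomial. -/
noncomputable def wilXi {n : ℕ} (x0 hh : Fin n → ℝ) (i : Fin n) : MvPolynomial (Fin n) ℝ :=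
  C (hh i)⁻¹ * (X i - C (x0 i))

lemma wil_dXi {n : ℕ} (x0 hh : Fin n → ℝ) (k i : Fin n) :
    pderiv k (wilXi x0 hh i) = if i = k then C (hh i)⁻¹ else 0 := by
  simp only [wilXi, pderiv_C_mul, map_sub, pderiv_C, sub_zero, pderiv_X, Pi.single_apply]
  split_ifs <;> simp

lemma wil_ddsq {n : ℕ} (x0 hh : Fin n → ℝ) (k i : Fin n) :
    pderiv k (pderiv k (wilXi x0 hh i ^ 2 - 1)) = if i = k then C (2 * (hh k)⁻¹ ^ 2) else 0 := by
  by_cases h : i = k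
  · subst h
    simp [wil_dXi, ← map_ofNat (C (σ := Fin n) (R := ℝ))]
    simp only [← inv_pow, C_pow]
    ring
  · simp [wil_dXi, h]

lemma wil_dd3 {n : ℕ} (x0 hh : Fin n → ℝ) (k i : Fin n) :
    pderiv k (pderiv k (wilXi x0 hh i ^ 3 - wilXi x0 hh i))
      = if i = k then C (6 * (hh k)⁻¹ ^ 2) * wilXi x0 hh k else 0 := by
  by_cases h : i = k
  · subst h
    simp [wil_dXi, ← map_ofNat (C (σ := Fin n) (R := ℝ))]
    rw [show (6 : ℝ) = 3 * 2 by norm_num, C_mul]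
    simp only [← inv_pow, C_pow]
    ring
  · simp [wil_dXi, h]

lemma wil_dd21 {n : ℕ} (x0 hh : Fin n → ℝ) (k i j : Fin n) (hij : j ≠ i) :
    pderiv k (pderiv k (wilXi x0 hh i ^ 2 * wilXi x0 hh j - wilXi x0 hh j))
      = if i = k then C (2 * (hh k)⁻¹ ^ 2) * wilXi x0 hh j else 0 := by
  by_cases h : i = k
  · subst h
    simp [wil_dXi, hij, ← map_ofNat (C (σ := Fin n) (R := ℝ))]
    simp only [← inv_pow, C_pow]
    ring
  · by_cases h' : j = k <;> simp [wil_dXi, h, h']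


/-- Error expansion of the Wilson interpolant of a cubic polynomial on an axis-parallel
box (used in the proof of Lemma 5.1): `q = q1 + Σᵢ cᵢ(ξᵢ² - 1)` with `q1 ∈ Q₁(K)` is a
Wilson interpolant of `u` (it matches `u` at the `2ⁿ` vertices of `K` and has the same
mean second pure derivatives over `K`); then
`u - q = Σᵢ (hᵢ³/6)·∂ᵢ³u·(ξᵢ³ - ξᵢ) + Σᵢ Σ_{j≠i} (hᵢ²hⱼ/2)·∂ᵢ²∂ⱼu·(ξᵢ²ξⱼ - ξⱼ)`,
where the (constant) third derivatives of `u` are evaluated at the center `x0`. -/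
theorem wilson_interpolation_error_expansion
    (n : ℕ) (x0 hh : Fin n → ℝ) (hh_pos : ∀ i, 0 < hh i)
    (u : MvPolynomial (Fin n) ℝ) (hu : u.totalDegree ≤ 3)
    (q q1 : MvPolynomial (Fin n) ℝ) (c : Fin n → ℝ)
    (hq1 : ∀ i, q1.degreeOf i ≤ 1)
    (hq : q = q1 + ∑ i, MvPolynomial.C (c i) *
      ((MvPolynomial.C (hh i)⁻¹ * (MvPolynomial.X i - MvPolynomial.C (x0 i))) ^ 2 - 1))
    (hvertex : ∀ ε : Fin n → Bool,
      MvPolynomial.eval (fun i => if ε i then x0 i + hh i else x0 i - hh i) q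
        = MvPolynomial.eval (fun i => if ε i then x0 i + hh i else x0 i - hh i) u)
    (hmean : ∀ i : Fin n,
      (∫ x in Set.univ.pi fun j => Set.Icc (x0 j - hh j) (x0 j + hh j),
        MvPolynomial.eval x (MvPolynomial.pderiv i (MvPolynomial.pderiv i q)))
      = ∫ x in Set.univ.pi fun j => Set.Icc (x0 j - hh j) (x0 j + hh j),
        MvPolynomial.eval x (MvPolynomial.pderiv i (MvPolynomial.pderiv i u))) :
    ∀ x : Fin n → ℝ,
      MvPolynomial.eval x u - MvPolynomial.eval x q
        = (∑ i, hh i ^ 3 / 6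
            * MvPolynomial.eval x0
                (MvPolynomial.pderiv i (MvPolynomial.pderiv i (MvPolynomial.pderiv i u)))
            * (((x i - x0 i) / hh i) ^ 3 - (x i - x0 i) / hh i))
          + ∑ i, ∑ j ∈ Finset.univ.erase i, hh i ^ 2 * hh j / 2
              * MvPolynomial.eval x0
                  (MvPolynomial.pderiv j (MvPolynomial.pderiv i (MvPolynomial.pderiv i u)))
              * (((x i - x0 i) / hh i) ^ 2 * ((x j - x0 j) / hh j)
                  - (x j - x0 j) / hh j) := by
  intro x
  set a : Fin n → Fin n → ℝ := fun i j => eval x0 (pderiv j (pderiv i (pderiv i u))) with ha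
  have hne : ∀ i, hh i ≠ 0 := fun i => (hh_pos i).ne'
  set R : MvPolynomial (Fin n) ℝ :=
    (∑ i, C (hh i ^ 3 / 6 * a i i) * (wilXi x0 hh i ^ 3 - wilXi x0 hh i))
      + ∑ i, ∑ j ∈ Finset.univ.erase i, C (hh i ^ 2 * hh j / 2 * a i j) *
        (wilXi x0 hh i ^ 2 * wilXi x0 hh j - wilXi x0 hh j) with hR
  have hevR : ∀ y : Fin n → ℝ, eval y R
      = (∑ i, hh i ^ 3 / 6 * a i i * (((y i - x0 i) / hh i) ^ 3 - (y i - x0 i) / hh i))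
          + ∑ i, ∑ j ∈ Finset.univ.erase i, hh i ^ 2 * hh j / 2 * a i j
              * (((y i - x0 i) / hh i) ^ 2 * ((y j - x0 j) / hh j)
                  - (y j - x0 j) / hh j) := by
    intro y
    simp only [hR, wilXi, map_add, map_sum, map_mul, map_sub, map_pow, eval_C, eval_X,
      div_eq_inv_mul]
  have hddR : ∀ k, pderiv k (pderiv k R) = ∑ j, C (a k j) * (X j - C (x0 j)) := by
    intro k
    have h1 : pderiv k (pderiv k R) = C (a k k) * (X k - C (x0 k))
        + ∑ j ∈ Finset.univ.erase k, C (a k j) * (X j - C (x0 j)) := by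
      rw [hR, map_add, map_add]
      congr 1
      · simp only [map_sum, pderiv_C_mul, wil_dd3]
        simp only [mul_ite, mul_zero, Finset.sum_ite_eq', Finset.mem_univ, if_true, wilXi]
        rw [← mul_assoc, ← mul_assoc, ← C_mul, ← C_mul]
        congr 2
        field_simp [hne k]
      · simp only [map_sum, pderiv_C_mul]
        rw [Finset.sum_eq_single k]
        · apply Finset.sum_congr rfl
          intro j hj
          rw [wil_dd21 _ _ _ _ _ (Finset.ne_of_mem_erase hj), if_pos rfl, wilXi,
            ← mul_assoc, ← mul_assoc, ← C_mul, ← C_mul]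
          congr 2
          have := hne j
          have := hne k
          field_simp
        · intro i _ hik
          apply Finset.sum_eq_zero
          intro j hj
          rw [wil_dd21 _ _ _ _ _ (Finset.ne_of_mem_erase hj), if_neg hik, mul_zero]
        · simp
    rw [h1]
    exact Finset.add_sum_erase Finset.univ (fun j => C (a k j) * (X j - C (x0 j)))
      (Finset.mem_univ k)
  have hddq : ∀ k, pderiv k (pderiv k q) = C (c k * (2 * (hh k)⁻¹ ^ 2)) := by
    intro k
    have hq' : q = q1 + ∑ i, C (c i) * (wilXi x0 hh i ^ 2 - 1) := hq
    rw [hq', map_add, map_add, wil_deg_to _ _ (hq1 k), zero_add]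
    simp only [map_sum, pderiv_C_mul, wil_ddsq]
    simp only [mul_ite, mul_zero, Finset.sum_ite_eq', Finset.mem_univ, if_true, ← C_mul]
  have hddu : ∀ k, pderiv k (pderiv k u)
      = C (eval x0 (pderiv k (pderiv k u))) + ∑ j, C (a k j) * (X j - C (x0 j)) := fun k =>
    wil_affine _ _ _ fun j => wil_third u hu x0 j k k
  have hdk : ∀ k, c k * (2 * (hh k)⁻¹ ^ 2) = eval x0 (pderiv k (pderiv k u)) := by
    intro k
    have h := hmean k
    rw [hddu k, wil_int, hddq k] at h
    have h0 := wil_int x0 hh (c k * (2 * (hh k)⁻¹ ^ 2)) 0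
    simp only [Pi.zero_apply, map_zero, zero_mul, Finset.sum_const_zero, add_zero] at h0
    rw [h0] at h
    exact mul_left_cancel₀ (wil_vol x0 hh hh_pos) h
  have hE : u - q - R = 0 := by
    apply eq_zero_of_eval_zero_at_prod_finset _ (fun i => {x0 i + hh i, x0 i - hh i})
    · intro i
      rw [Finset.card_pair (by linarith [hh_pos i])]
      apply wil_deg_of
      simp only [map_sub]
      rw [hddu i, hddq i, hddR i, hdk i]
      ring
    · intro y hy
      have hy' : ∀ i, y i = x0 i + hh i ∨ y i = x0 i - hh i := fun i => by simpa using hy i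
      have hsq : ∀ i, ((y i - x0 i) / hh i) ^ 2 = 1 := by
        intro i
        have := hne i
        rcases hy' i with h | h <;> rw [h] <;> field_simp <;> ring
      have hyv : (fun i => if (decide (y i = x0 i + hh i)) then x0 i + hh i else x0 i - hh i)
          = y := by
        ext i
        by_cases h : y i = x0 i + hh i
        · simp [h]
        · simpa [h] using ((hy' i).resolve_left h).symm
      have hv := hvertex (fun i => decide (y i = x0 i + hh i))
      rw [hyv] at hv
      rw [map_sub, map_sub, hv, sub_self, zero_sub, hevR]
      have e1 : ∀ i, ((y i - x0 i) / hh i) ^ 3 - (y i - x0 i) / hh i = 0 := by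
        intro i
        rw [pow_succ, hsq i]
        ring
      simp [e1, hsq]
  rw [← map_sub, sub_eq_zero.mp hE, hevR]
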